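/- Let N ≥ 4, s ∈ [1, 2*−1). Assume Q ∈ C(Ω̄) ∩ C²(Ω) with Q ≥ 0, and let a_1,…,a_m ∈ Ω be distinct points with Q(a_j) > 0. Suppose ε_n → 0⁺ and for each n, u_n is a solution of problem (1.1) with parameter ε_n, and the sequence (u_n) satisfies the concentration condition (1.3) at a_1,…,a_m. Then ∇Q(a_j) = 0 for every j = 1,…,m. -/

import Mathlib

open MeasureTheory Metric Real Filter Topology Set

noncomputable section

/-- The critical Sobolev exponent `2* = 2N/(N-2)`. -/
def twoStar (N : ℕ) : ℝ := 2 * N / ((N : ℝ) - 2)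

/-- The Laplacian of `u : ℝ^N → ℝ`, as the sum of the second partial derivatives
in the coordinate directions. -/
def laplacian {N : ℕ} (u : EuclideanSpace ℝ (Fin N) → ℝ)
    (x : EuclideanSpace ℝ (Fin N)) : ℝ :=
  ∑ i : Fin N,
    fderiv ℝ (fun y => fderiv ℝ u y (EuclideanSpace.single i 1)) x (EuclideanSpace.single i 1)

/-- The Aubin–Talenti bubble
`U_{x,λ}(y) = (N(N-2))^{(N-2)/4} λ^{(N-2)/2} (1 + λ²|y-x|²)^{-(N-2)/2}`. -/
def bubble (N : ℕ) (x : EuclideanSpace ℝ (Fin N)) (lam : ℝ)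
    (y : EuclideanSpace ℝ (Fin N)) : ℝ :=
  ((N : ℝ) * ((N : ℝ) - 2)) ^ (((N : ℝ) - 2) / 4) * lam ^ (((N : ℝ) - 2) / 2) /
    (1 + lam ^ 2 * ‖y - x‖ ^ 2) ^ (((N : ℝ) - 2) / 2)

/-- `S^{N/2} = ∫_{ℝ^N} U_{0,1}^{2*}`, where `S` is the best Sobolev constant. -/
def SNhalf (N : ℕ) : ℝ :=
  ∫ y : EuclideanSpace ℝ (Fin N), bubble N 0 1 y ^ twoStar N

/-- `Ω` has smooth boundary: near every boundary point, `Ω` is given by a smooth local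
defining function with non-vanishing differential. -/
def SmoothBoundary {N : ℕ} (Ω : Set (EuclideanSpace ℝ (Fin N))) : Prop :=
  ∀ x ∈ frontier Ω, ∃ (V : Set (EuclideanSpace ℝ (Fin N))) (g : EuclideanSpace ℝ (Fin N) → ℝ),
    IsOpen V ∧ x ∈ V ∧ ContDiff ℝ (⊤ : ℕ∞) g ∧ (∀ y ∈ V, (y ∈ Ω ↔ g y < 0)) ∧
    ∀ y ∈ V, fderiv ℝ g y ≠ 0

/-- `u` is a (classical) solution of problem (1.1):
`u ∈ C²(Ω) ∩ C(Ω̄)`, `u > 0` in `Ω`, `u = 0` on `∂Ω`, and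
`-Δu = Q(x) u^{2*-1} + ε u^s` in `Ω`. -/
def IsSolution {N : ℕ} (Ω : Set (EuclideanSpace ℝ (Fin N)))
    (Q : EuclideanSpace ℝ (Fin N) → ℝ) (ε s : ℝ)
    (u : EuclideanSpace ℝ (Fin N) → ℝ) : Prop :=
  ContDiffOn ℝ 2 u Ω ∧ ContinuousOn u (closure Ω) ∧
  (∀ x ∈ Ω, 0 < u x) ∧ (∀ x ∈ frontier Ω, u x = 0) ∧
  ∀ x ∈ Ω, -laplacian u x = Q x * u x ^ (twoStar N - 1) + ε * u x ^ s

/-- The concentration condition (1.3) at the points `a 1, …, a m`, along a filter `l`: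
tested against every bounded continuous `φ`,
`∫_Ω |∇u_n|² φ → Σ_j Q(a_j)^{-(N-2)/2} S^{N/2} φ(a_j)` and
`∫_Ω u_n^{2*} φ → Σ_j Q(a_j)^{-N/2} S^{N/2} φ(a_j)`. -/
def Concentrates {N : ℕ} (Ω : Set (EuclideanSpace ℝ (Fin N)))
    (Q : EuclideanSpace ℝ (Fin N) → ℝ) {ι : Type*} (l : Filter ι)
    (u : ι → EuclideanSpace ℝ (Fin N) → ℝ) {m : ℕ}
    (a : Fin m → EuclideanSpace ℝ (Fin N)) : Prop :=
  ∀ φ : EuclideanSpace ℝ (Fin N) → ℝ, Continuous φ → (∃ C, ∀ x, |φ x| ≤ C) →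
    Tendsto (fun n => ∫ x in Ω, ‖gradient (u n) x‖ ^ 2 * φ x) l
      (nhds (∑ j, Q (a j) ^ (-(((N : ℝ) - 2) / 2)) * SNhalf N * φ (a j))) ∧
    Tendsto (fun n => ∫ x in Ω, u n x ^ twoStar N * φ x) l
      (nhds (∑ j, Q (a j) ^ (-((N : ℝ) / 2)) * SNhalf N * φ (a j)))

/-- The partial derivative of `f` in the `i`-th coordinate direction. -/
def partialDeriv {N : ℕ} (i : Fin N) (f : EuclideanSpace ℝ (Fin N) → ℝ)
    (x : EuclideanSpace ℝ (Fin N)) : ℝ :=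
  fderiv ℝ f x (EuclideanSpace.single i 1)

theorem norm_gradient_sq {N : ℕ} (f : EuclideanSpace ℝ (Fin N) → ℝ)
    (x : EuclideanSpace ℝ (Fin N)) :
    ‖gradient f x‖ ^ 2 = ∑ i, partialDeriv i f x ^ 2 := by
  rw [EuclideanSpace.norm_sq_eq]
  refine Finset.sum_congr rfl fun i _ => ?_
  have h : partialDeriv i f x = gradient f x i := by
    rw [partialDeriv, ← InnerProductSpace.toDual_symm_apply (𝕜 := ℝ), ← gradient,
      real_inner_comm, EuclideanSpace.inner_single_left]
    simp
  rw [h, Real.norm_eq_abs, sq_abs]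

theorem abs_partialDeriv_mul_le {N : ℕ} (i k : Fin N) (f : EuclideanSpace ℝ (Fin N) → ℝ)
    (x : EuclideanSpace ℝ (Fin N)) :
    |partialDeriv i f x * partialDeriv k f x| ≤ ‖gradient f x‖ ^ 2 := by
  have hle : ∀ j, partialDeriv j f x ^ 2 ≤ ‖gradient f x‖ ^ 2 := fun j => by
    rw [norm_gradient_sq]
    exact Finset.single_le_sum (f := fun i => partialDeriv i f x ^ 2)
      (fun i _ => sq_nonneg _) (Finset.mem_univ j)
  rw [abs_le]
  constructor <;>
    nlinarith [hle i, hle k, sq_nonneg (partialDeriv i f x + partialDeriv k f x),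
      sq_nonneg (partialDeriv i f x - partialDeriv k f x)]

theorem ContDiffOn.partialDeriv {N : ℕ} {Ω : Set (EuclideanSpace ℝ (Fin N))} (hΩ : IsOpen Ω)
    {f : EuclideanSpace ℝ (Fin N) → ℝ} (hf : ContDiffOn ℝ 2 f Ω) (i : Fin N) :
    ContDiffOn ℝ 1 (partialDeriv i f) Ω :=
  (hf.fderiv_of_isOpen hΩ (by norm_num)).clm_apply contDiffOn_const

theorem ContDiffOn.continuousOn_partialDeriv {N : ℕ} {Ω : Set (EuclideanSpace ℝ (Fin N))}
    (hΩ : IsOpen Ω) {f : EuclideanSpace ℝ (Fin N) → ℝ} (hf : ContDiffOn ℝ 1 f Ω) (i : Fin N) :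
    ContinuousOn (_root_.partialDeriv i f) Ω :=
  (hf.continuousOn_fderiv_of_isOpen hΩ le_rfl).clm_apply continuousOn_const

theorem partialDeriv_comm {N : ℕ} {Ω : Set (EuclideanSpace ℝ (Fin N))} (hΩ : IsOpen Ω)
    {f : EuclideanSpace ℝ (Fin N) → ℝ} (hf : ContDiffOn ℝ 2 f Ω) (i k : Fin N)
    {x : EuclideanSpace ℝ (Fin N)} (hx : x ∈ Ω) :
    partialDeriv i (partialDeriv k f) x = partialDeriv k (partialDeriv i f) x := by
  have hfx : ContDiffAt ℝ 2 f x := hf.contDiffAt (hΩ.mem_nhds hx)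
  have hd : DifferentiableAt ℝ (fderiv ℝ f) x :=
    (hfx.fderiv_right (m := 1) (by norm_num)).differentiableAt one_ne_zero
  have h : ∀ i k : Fin N, partialDeriv i (partialDeriv k f) x =
      fderiv ℝ (fderiv ℝ f) x (EuclideanSpace.single i 1) (EuclideanSpace.single k 1) := by
    intro i k
    have : HasFDerivAt (partialDeriv k f) _ x :=
      hd.hasFDerivAt.clm_apply (hasFDerivAt_const (EuclideanSpace.single k (1 : ℝ)) x)
    rw [partialDeriv, this.fderiv]
    simp
  rw [h, h]
  exact (hfx.isSymmSndFDerivAt (by simp)) _ _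

theorem continuous_mul_of_tsupport_subset {X : Type*} [TopologicalSpace X] {Ω : Set X}
    (hΩ : IsOpen Ω) {χ g : X → ℝ} (hχ : Continuous χ) (hs : tsupport χ ⊆ Ω)
    (hg : ContinuousOn g Ω) : Continuous fun x => χ x * g x := by
  refine continuous_of_tsupport fun x hx => ?_
  have hxΩ : x ∈ Ω := hs (tsupport_mul_subset_left hx)
  exact hχ.continuousAt.mul (hg.continuousAt (hΩ.mem_nhds hxΩ))

theorem integrable_mul_of_tsupport_subset {N : ℕ} {Ω : Set (EuclideanSpace ℝ (Fin N))}
    (hΩ : IsOpen Ω) {χ g : EuclideanSpace ℝ (Fin N) → ℝ} (hχ : Continuous χ)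
    (hc : HasCompactSupport χ) (hs : tsupport χ ⊆ Ω) (hg : ContinuousOn g Ω) :
    Integrable fun x => χ x * g x :=
  (continuous_mul_of_tsupport_subset hΩ hχ hs hg).integrable_of_hasCompactSupport hc.mul_right

theorem continuous_partialDeriv {N : ℕ} {η : EuclideanSpace ℝ (Fin N) → ℝ}
    (hη : ContDiff ℝ 1 η) (i : Fin N) : Continuous (partialDeriv i η) :=
  (hη.continuous_fderiv one_ne_zero).clm_apply continuous_const

theorem tsupport_partialDeriv_subset {N : ℕ} (η : EuclideanSpace ℝ (Fin N) → ℝ) (i : Fin N) :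
    tsupport (partialDeriv i η) ⊆ tsupport η :=
  tsupport_fderiv_apply_subset ℝ _

theorem HasCompactSupport.partialDeriv {N : ℕ} {η : EuclideanSpace ℝ (Fin N) → ℝ}
    (hc : HasCompactSupport η) (i : Fin N) : HasCompactSupport (_root_.partialDeriv i η) :=
  hc.fderiv_apply ℝ _

theorem integral_partialDeriv_mul {N : ℕ} {Ω : Set (EuclideanSpace ℝ (Fin N))}
    (hΩ : IsOpen Ω) {η g : EuclideanSpace ℝ (Fin N) → ℝ} (hη : ContDiff ℝ 1 η)
    (hc : HasCompactSupport η) (hs : tsupport η ⊆ Ω) (hg : ContDiffOn ℝ 1 g Ω) (i : Fin N) :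
    ∫ x, partialDeriv i η x * g x = -∫ x, η x * partialDeriv i g x := by
  have h := integral_mul_fderiv_eq_neg_fderiv_mul_of_integrable (μ := volume)
    (f := η) (g := g) (v := EuclideanSpace.single i 1)
    (integrable_mul_of_tsupport_subset hΩ (continuous_partialDeriv hη i) (hc.partialDeriv i)
      ((tsupport_partialDeriv_subset η i).trans hs) hg.continuousOn)
    (integrable_mul_of_tsupport_subset hΩ hη.continuous hc hs
      (hg.continuousOn_partialDeriv hΩ i))
    (integrable_mul_of_tsupport_subset hΩ hη.continuous hc hs hg.continuousOn)
    (fun x _ => hη.differentiable one_ne_zero x)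
    (fun x hx => (hg.differentiableOn one_ne_zero).differentiableAt (hΩ.mem_nhds (hs hx)))
  simp only [partialDeriv, h, neg_neg]

/-- The translation Pohozaev identity, localized by a cutoff `η`. -/
theorem local_pohozaev {N : ℕ} {Ω : Set (EuclideanSpace ℝ (Fin N))} (hΩ : IsOpen Ω)
    {Q u η : EuclideanSpace ℝ (Fin N) → ℝ} {p s ε : ℝ} (hp : p ≠ 0) (hs1 : s + 1 ≠ 0)
    (hη : ContDiff ℝ 1 η) (hc : HasCompactSupport η) (hs : tsupport η ⊆ Ω)
    (hQ : ContDiffOn ℝ 1 Q Ω) (hu : ContDiffOn ℝ 2 u Ω) (hpos : ∀ x ∈ Ω, 0 < u x)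
    (heq : ∀ x ∈ Ω, -laplacian u x = Q x * u x ^ (p - 1) + ε * u x ^ s) (i : Fin N) :
    (∑ k, ∫ x, partialDeriv k η x * (partialDeriv i u x * partialDeriv k u x)) +
      ∫ x, partialDeriv i η x * (Q x * u x ^ p / p + ε * u x ^ (s + 1) / (s + 1)
        - (∑ k, partialDeriv k u x ^ 2) / 2) =
    -∫ x, η x * (partialDeriv i Q x * u x ^ p / p) := by
  have hu1 : ContDiffOn ℝ 1 u Ω := hu.of_le (by norm_num)
  have hd : ∀ k, ContDiffOn ℝ 1 (partialDeriv k u) Ω := fun k => hu.partialDeriv hΩ k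
  have hpow : ∀ r : ℝ, ContDiffOn ℝ 1 (fun x => u x ^ r) Ω := fun r =>
    hu1.rpow_const_of_ne fun x hx => (hpos x hx).ne'
  have hprod : ∀ k, ContDiffOn ℝ 1 (fun x => partialDeriv i u x * partialDeriv k u x) Ω :=
    fun k => (hd i).mul (hd k)
  have hH : ContDiffOn ℝ 1 (fun x => Q x * u x ^ p / p + ε * u x ^ (s + 1) / (s + 1)
        - (∑ k, partialDeriv k u x ^ 2) / 2) Ω :=
    (((hQ.mul (hpow p)).div_const _).add ((contDiffOn_const.mul (hpow _)).div_const _)).sub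
      ((ContDiffOn.sum fun k _ => (hd k).pow 2).div_const _)
  simp_rw [integral_partialDeriv_mul hΩ hη hc hs (hprod _)]
  rw [integral_partialDeriv_mul hΩ hη hc hs hH, Finset.sum_neg_distrib, ← neg_add, neg_inj,
    ← integral_finsetSum _ fun k _ => integrable_mul_of_tsupport_subset hΩ hη.continuous hc hs
      ((hprod k).continuousOn_partialDeriv hΩ k),
    ← integral_add (integrable_finsetSum _ fun k _ => integrable_mul_of_tsupport_subset hΩ
      hη.continuous hc hs ((hprod k).continuousOn_partialDeriv hΩ k))
      (integrable_mul_of_tsupport_subset hΩ hη.continuous hc hs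
        (hH.continuousOn_partialDeriv hΩ i))]
  refine integral_congr_ae (Eventually.of_forall fun x => ?_)
  by_cases hx : x ∈ Ω
  swap
  · simp [image_eq_zero_of_notMem_tsupport fun h => hx (hs h)]
  have hder : ∀ {f : EuclideanSpace ℝ (Fin N) → ℝ}, ContDiffOn ℝ 1 f Ω →
      HasFDerivAt f (fderiv ℝ f x) x := fun hf =>
    ((hf.differentiableOn one_ne_zero).differentiableAt (hΩ.mem_nhds hx)).hasFDerivAt
  have h1 : ∀ k, partialDeriv k (fun x => partialDeriv i u x * partialDeriv k u x) x =
      partialDeriv i u x * partialDeriv k (partialDeriv k u) x +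
        partialDeriv k u x * partialDeriv i (partialDeriv k u) x := by
    intro k
    rw [partialDeriv_comm hΩ hu i k hx]
    refine (congrArg (fun L => L (EuclideanSpace.single k 1))
      ((hder (hd i)).mul (hder (hd k))).fderiv).trans ?_
    simp [partialDeriv]
  have h2 : partialDeriv i (fun x => Q x * u x ^ p / p + ε * u x ^ (s + 1) / (s + 1)
        - (∑ k, partialDeriv k u x ^ 2) / 2) x =
      partialDeriv i Q x * u x ^ p / p + (Q x * u x ^ (p - 1) + ε * u x ^ s) * partialDeriv i u x
        - ∑ k, partialDeriv k u x * partialDeriv i (partialDeriv k u) x := by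
    have hup : ∀ r : ℝ, HasFDerivAt (fun x => u x ^ r) ((r * u x ^ (r - 1)) • fderiv ℝ u x) x :=
      fun r => (hder hu1).rpow_const (Or.inl (hpos x hx).ne')
    have hF := ((((hder hQ).mul (hup p)).mul_const p⁻¹).add
      (((hup (s + 1)).const_mul ε).mul_const (s + 1)⁻¹)).sub
      ((HasFDerivAt.fun_sum (u := Finset.univ) fun k _ => (hder (hd k)).pow 2).mul_const
        (2 : ℝ)⁻¹)
    simp only [← div_eq_mul_inv] at hF
    have hF' := hF.fderiv
    rw [partialDeriv]
    refine (congrArg (fun L => L (EuclideanSpace.single i 1)) hF').trans ?_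
    simp only [_root_.sub_apply, _root_.add_apply,
      _root_.smul_apply, _root_.sum_apply, smul_eq_mul,
      Finset.mul_sum, add_sub_cancel_right, partialDeriv]
    congr 1
    · field_simp
      ring
    · refine Finset.sum_congr rfl fun k _ => ?_
      simp [mul_assoc]
  have h3 : laplacian u x = ∑ k, partialDeriv k (partialDeriv k u) x := rfl
  have h4 := heq x hx
  simp only [h1, h2]
  rw [← Finset.mul_sum, ← mul_add, Finset.sum_add_distrib, ← Finset.mul_sum, ← h3, ← h4]
  ring

theorem SNhalf_pos {N : ℕ} (hN : 2 < N) : 0 < SNhalf N := by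
  have hN' : (2 : ℝ) < N := by exact_mod_cast hN
  set c : ℝ := ((N : ℝ) * ((N : ℝ) - 2)) ^ (((N : ℝ) - 2) / 4) with hc
  have hc0 : 0 < c := rpow_pos_of_pos (mul_pos (by linarith) (by linarith)) _
  have hfun : ∀ y : EuclideanSpace ℝ (Fin N),
      bubble N 0 1 y ^ twoStar N = c ^ twoStar N * (1 + ‖y‖ ^ 2) ^ (-(2 * (N : ℝ)) / 2) := by
    intro y
    have h1 : (0 : ℝ) < 1 + ‖y‖ ^ 2 := by positivity
    have h2 : (N : ℝ) - 2 ≠ 0 := by linarith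
    simp only [bubble, one_rpow, mul_one, one_pow, one_mul, sub_zero, ← hc]
    rw [div_rpow hc0.le (rpow_nonneg h1.le _), ← rpow_mul h1.le, div_eq_mul_inv,
      ← rpow_neg h1.le]
    congr 2
    rw [twoStar]
    field_simp
  have hint : Integrable fun y : EuclideanSpace ℝ (Fin N) =>
      c ^ twoStar N * (1 + ‖y‖ ^ 2) ^ (-(2 * (N : ℝ)) / 2) :=
    (integrable_rpow_neg_one_add_norm_sq (by simp; linarith)).const_mul _
  have hpos : ∀ y : EuclideanSpace ℝ (Fin N),
      0 < c ^ twoStar N * (1 + ‖y‖ ^ 2) ^ (-(2 * (N : ℝ)) / 2) := fun y =>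
    mul_pos (rpow_pos_of_pos hc0 _) (rpow_pos_of_pos (by positivity) _)
  rw [SNhalf]
  simp_rw [hfun]
  rw [integral_pos_iff_support_of_nonneg (fun y => (hpos y).le) hint]
  have : (Function.support fun y : EuclideanSpace ℝ (Fin N) =>
      c ^ twoStar N * (1 + ‖y‖ ^ 2) ^ (-(2 * (N : ℝ)) / 2)) = univ := by
    ext y
    simpa using (hpos y).ne'
  rw [this]
  exact isOpen_univ.measure_pos _ univ_nonempty

theorem Concentrates.tendsto_integral {N : ℕ} {Ω : Set (EuclideanSpace ℝ (Fin N))}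
    {Q : EuclideanSpace ℝ (Fin N) → ℝ} {ι : Type*} {l : Filter ι}
    {u : ι → EuclideanSpace ℝ (Fin N) → ℝ} {m : ℕ} {a : Fin m → EuclideanSpace ℝ (Fin N)}
    (h : Concentrates Ω Q l u a) {χ : EuclideanSpace ℝ (Fin N) → ℝ} (hχ : Continuous χ)
    (hc : HasCompactSupport χ) (hs : tsupport χ ⊆ Ω) :
    Tendsto (fun n => ∫ x, χ x * ‖gradient (u n) x‖ ^ 2) l
      (𝓝 (∑ j, Q (a j) ^ (-(((N : ℝ) - 2) / 2)) * SNhalf N * χ (a j))) ∧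
    Tendsto (fun n => ∫ x, χ x * u n x ^ twoStar N) l
      (𝓝 (∑ j, Q (a j) ^ (-((N : ℝ) / 2)) * SNhalf N * χ (a j))) := by
  obtain ⟨C, hC⟩ := hc.exists_bound_of_continuous hχ
  have hset : ∀ g : EuclideanSpace ℝ (Fin N) → ℝ,
      ∫ x in Ω, g x * χ x = ∫ x, χ x * g x := fun g => by
    rw [setIntegral_eq_integral_of_forall_compl_eq_zero fun x hx => by
      rw [image_eq_zero_of_notMem_tsupport fun h' => hx (hs h'), mul_zero]]
    simp only [mul_comm]
  simpa only [hset] using h χ hχ ⟨C, hC⟩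

/-- If `u_n` are solutions of (1.1) with parameters `ε_n → 0⁺` that concentrate at the
points `a_1, …, a_m`, then `∇Q(a_j) = 0` for every `j`. -/
theorem grad_Q_vanishes_at_concentration_points
    (N : ℕ) (hN : 4 ≤ N) (s : ℝ) (hs1 : 1 ≤ s) (hs2 : s < twoStar N - 1)
    (Ω : Set (EuclideanSpace ℝ (Fin N))) (hΩo : IsOpen Ω)
    (hΩb : Bornology.IsBounded Ω) (hΩc : IsConnected Ω) (hΩs : SmoothBoundary Ω)
    (Q : EuclideanSpace ℝ (Fin N) → ℝ)
    (hQc : ContinuousOn Q (closure Ω)) (hQ2 : ContDiffOn ℝ 2 Q Ω)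
    (hQ0 : ∀ x ∈ closure Ω, 0 ≤ Q x)
    (m : ℕ) (hm : 0 < m) (a : Fin m → EuclideanSpace ℝ (Fin N))
    (ha : Function.Injective a) (haΩ : ∀ j, a j ∈ Ω) (haQ : ∀ j, 0 < Q (a j))
    (ε : ℕ → ℝ) (hε : ∀ n, 0 < ε n) (hε0 : Tendsto ε atTop (nhds 0))
    (u : ℕ → EuclideanSpace ℝ (Fin N) → ℝ)
    (hu : ∀ n, IsSolution Ω Q (ε n) s (u n))
    (hconc : Concentrates Ω Q atTop u a) :
    ∀ j, fderiv ℝ Q (a j) = 0 := by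
  intro j
  have hNR : (4 : ℝ) ≤ N := by exact_mod_cast hN
  have hp : 0 < twoStar N := div_pos (by linarith) (by linarith)
  have hQ1 : ContDiffOn ℝ 1 Q Ω := hQ2.of_le (by norm_num)
  obtain ⟨r, hr, hrsub⟩ : ∃ r > 0, closedBall (a j) r ⊆ Ω \ (a '' {k | k ≠ j}) := by
    refine Metric.nhds_basis_closedBall.mem_iff.1 (IsOpen.mem_nhds ?_ ⟨haΩ j, ?_⟩)
    · exact hΩo.sdiff (Set.toFinite _).isClosed
    · rintro ⟨k, hk, hkj⟩
      exact hk (ha hkj)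
  let η : ContDiffBump (a j) := ⟨r / 2, r, by positivity, by linarith⟩
  have hη : ContDiff ℝ 1 η := η.contDiff
  have hc : HasCompactSupport η := η.hasCompactSupport
  have hts : tsupport η ⊆ Ω := by
    rw [η.tsupport_eq]
    exact fun x hx => (hrsub hx).1
  have hηk : ∀ k, k ≠ j → a k ∉ tsupport η := by
    intro k hk hmem
    rw [η.tsupport_eq] at hmem
    exact (hrsub hmem).2 ⟨k, hk, rfl⟩
  have hη0 : ∀ (i : Fin N) (k : Fin m), partialDeriv i η (a k) = 0 := by
    intro i k
    by_cases hk : k = j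
    · subst hk
      rw [partialDeriv, η.eventuallyEq_one.fderiv_eq]
      simp
    · exact image_eq_zero_of_notMem_tsupport fun h =>
        hηk k hk (tsupport_partialDeriv_subset _ i h)
  have hdc : ∀ i, Continuous (partialDeriv i η) := fun i => continuous_partialDeriv hη i
  have hdcs : ∀ i, HasCompactSupport (partialDeriv i η) := fun i => hc.partialDeriv i
  have hdts : ∀ i, tsupport (partialDeriv i η) ⊆ Ω := fun i =>
    (tsupport_partialDeriv_subset _ i).trans hts
  have habss : ∀ i, HasCompactSupport fun x => |partialDeriv i η x| := fun i => (hdcs i).norm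
  have habst : ∀ i, tsupport (fun x => |partialDeriv i η x|) ⊆ Ω := fun i =>
    (closure_mono fun x hx => by simpa using hx).trans (hdts i)
  have hpow : ∀ (n : ℕ) (r : ℝ), ContinuousOn (fun x => u n x ^ r) Ω := fun n r =>
    (hu n).1.continuousOn.rpow_const fun x hx => Or.inl ((hu n).2.2.1 x hx).ne'
  have hgrad : ∀ n k, ContinuousOn (partialDeriv k (u n)) Ω := fun n k =>
    ((hu n).1.of_le (by norm_num)).continuousOn_partialDeriv hΩo k
  have hgradsq : ∀ n, ContinuousOn (fun x => ‖gradient (u n) x‖ ^ 2) Ω := fun n => by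
    simp_rw [norm_gradient_sq]
    exact continuousOn_finsetSum _ fun k _ => (hgrad n k).pow 2
  have hlim1 : ∀ i k, Tendsto (fun n => ∫ x, partialDeriv k η x *
      (partialDeriv i (u n) x * partialDeriv k (u n) x)) atTop (𝓝 0) := by
    intro i k
    have h := (hconc.tendsto_integral (hdc k).abs (habss k) (habst k)).1
    simp only [hη0, abs_zero, mul_zero, Finset.sum_const_zero] at h
    refine squeeze_zero_norm (fun n => ?_) h
    refine norm_integral_le_of_norm_le (integrable_mul_of_tsupport_subset hΩo (hdc k).abs
      (habss k) (habst k) (hgradsq n)) (Eventually.of_forall fun x => ?_)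
    rw [norm_mul, Real.norm_eq_abs, Real.norm_eq_abs]
    exact mul_le_mul_of_nonneg_left (abs_partialDeriv_mul_le i k _ x) (abs_nonneg _)
  have hlimQ : ∀ i, Tendsto (fun n => ∫ x, partialDeriv i η x * (Q x * u n x ^ twoStar N))
      atTop (𝓝 0) := by
    intro i
    have h := (hconc.tendsto_integral (continuous_mul_of_tsupport_subset hΩo (hdc i) (hdts i)
      hQ1.continuousOn) (hdcs i).mul_right
      ((tsupport_mul_subset_left (f := partialDeriv i η)).trans (hdts i))).2
    simpa only [hη0, zero_mul, mul_zero, Finset.sum_const_zero, mul_assoc] using h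
  have hlimε : ∀ i, Tendsto (fun n => ε n * ∫ x, partialDeriv i η x * u n x ^ (s + 1))
      atTop (𝓝 0) := by
    intro i
    have h := (hconc.tendsto_integral (hdc i).abs (habss i) (habst i)).2
    have h' := hε0.mul (h.const_add (∫ x, |partialDeriv i η x| * 1))
    rw [zero_mul] at h'
    refine squeeze_zero_norm (fun n => ?_) h'
    have hi1 := integrable_mul_of_tsupport_subset hΩo (hdc i).abs (habss i) (habst i)
      (continuousOn_const (c := (1 : ℝ)))
    have hi2 := integrable_mul_of_tsupport_subset hΩo (hdc i).abs (habss i) (habst i)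
      (hpow n (twoStar N))
    rw [norm_mul, Real.norm_eq_abs, abs_of_pos (hε n), ← integral_add hi1 hi2]
    refine mul_le_mul_of_nonneg_left (norm_integral_le_of_norm_le (hi1.add hi2)
      (Eventually.of_forall fun x => ?_)) (hε n).le
    by_cases hx : x ∈ Ω
    · have hux := (hu n).2.2.1 x hx
      have hle : u n x ^ (s + 1) ≤ 1 + u n x ^ twoStar N := by
        rcases le_total (u n x) 1 with h1 | h1
        · linarith [rpow_le_one hux.le h1 (by linarith : 0 ≤ s + 1),
            rpow_nonneg hux.le (twoStar N)]
        · linarith [rpow_le_rpow_of_exponent_le h1 (by linarith : s + 1 ≤ twoStar N)]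
      rw [norm_mul, Real.norm_eq_abs, Real.norm_eq_abs, abs_of_nonneg (rpow_nonneg hux.le _)]
      simpa only [Pi.add_apply, ← mul_add] using mul_le_mul_of_nonneg_left hle (abs_nonneg _)
    · simp [image_eq_zero_of_notMem_tsupport fun h => hx (hdts i h)]
  have hlimG : ∀ i, Tendsto (fun n => ∫ x, partialDeriv i η x * ‖gradient (u n) x‖ ^ 2)
      atTop (𝓝 0) := by
    intro i
    have h := (hconc.tendsto_integral (hdc i) (hdcs i) (hdts i)).1
    simpa only [hη0, mul_zero, Finset.sum_const_zero] using h
  have hcQ : ∀ i, Continuous fun x => η x * partialDeriv i Q x := fun i =>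
    continuous_mul_of_tsupport_subset hΩo hη.continuous hts
      (hQ1.continuousOn_partialDeriv hΩo i)
  have hpartial : ∀ i, partialDeriv i Q (a j) = 0 := by
    intro i
    have hA := (hconc.tendsto_integral (hcQ i) hc.mul_right
      ((tsupport_mul_subset_left (f := η)).trans hts)).2
    have hB : Tendsto (fun n => ∫ x, η x * partialDeriv i Q x * u n x ^ twoStar N) atTop
        (𝓝 0) := by
      have hsum := (tendsto_finsetSum Finset.univ fun k _ => hlim1 i k).add
        ((((hlimQ i).div_const (twoStar N)).add ((hlimε i).div_const (s + 1))).sub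
          ((hlimG i).div_const 2))
      have hneg := hsum.mul_const (-twoStar N)
      simp only [Finset.sum_const_zero, zero_div, add_zero, sub_zero, zero_mul] at hneg
      refine hneg.congr fun n => ?_
      have hpoh := local_pohozaev hΩo hp.ne' (by linarith : s + 1 ≠ 0) hη hc hts hQ1 (hu n).1
        (hu n).2.2.1 (hu n).2.2.2.2 i
      have hi1 : Integrable fun x => partialDeriv i η x * (Q x * u n x ^ twoStar N) :=
        integrable_mul_of_tsupport_subset hΩo (hdc i) (hdcs i) (hdts i)
          (hQ1.continuousOn.mul (hpow n (twoStar N)))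
      have hi2 := integrable_mul_of_tsupport_subset hΩo (hdc i) (hdcs i) (hdts i)
        (hpow n (s + 1))
      have hi3 := integrable_mul_of_tsupport_subset hΩo (hdc i) (hdcs i) (hdts i) (hgradsq n)
      have hsplit : ∫ x, partialDeriv i η x * (Q x * u n x ^ twoStar N / twoStar N
          + ε n * u n x ^ (s + 1) / (s + 1) - (∑ k, partialDeriv k (u n) x ^ 2) / 2) =
          (∫ x, partialDeriv i η x * (Q x * u n x ^ twoStar N)) / twoStar N
          + (ε n * ∫ x, partialDeriv i η x * u n x ^ (s + 1)) / (s + 1)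
          - (∫ x, partialDeriv i η x * ‖gradient (u n) x‖ ^ 2) / 2 := by
        rw [← integral_div, ← integral_const_mul, ← integral_div, ← integral_div,
          ← integral_add' (hi1.div_const _) ((hi2.const_mul _).div_const _),
          ← integral_sub' ((hi1.div_const _).add ((hi2.const_mul _).div_const _))
            (hi3.div_const _)]
        refine integral_congr_ae (Eventually.of_forall fun x => ?_)
        simp only [norm_gradient_sq, Pi.add_apply, Pi.sub_apply]
        ring
      rw [← hsplit, hpoh, neg_mul_neg, ← integral_mul_const]
      refine integral_congr_ae (Eventually.of_forall fun x => ?_)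
      have := hp.ne'
      simp only
      field_simp
    have hlim := tendsto_nhds_unique hA hB
    rw [Finset.sum_eq_single j (fun k _ hk => by
      rw [image_eq_zero_of_notMem_tsupport (hηk k hk), zero_mul, mul_zero]) (by simp),
      η.eventuallyEq_one.eq_of_nhds, Pi.one_apply, one_mul] at hlim
    exact (mul_eq_zero.1 hlim).resolve_left
      (mul_pos (rpow_pos_of_pos (haQ j) _) (SNhalf_pos (by omega))).ne'
  ext v
  have hv : v = ∑ i, v i • EuclideanSpace.single i (1 : ℝ) := by
    ext k
    simp [Finset.sum_apply, Pi.single_apply]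
  rw [hv, map_sum]
  refine (Finset.sum_eq_zero fun i _ => ?_).trans (by simp)
  rw [map_smul]
  exact (congrArg (v i • ·) (hpartial i)).trans (smul_zero _)

end
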